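/- arXiv:2505.20417 — 3 statements merged into one kernel-verified Lean document; each statement's English description precedes it below -/
import Mathlib

section
/- For a finite set P of N players and a characteristic function v : Finset P → ℝ with v(∅) = 0, the Shapley values SV_i(v) = Σ_{S ⊆ P \ {i}} (|S|! · (N − |S| − 1)! / N!) · (v(S ∪ {i}) − v(S)) satisfy the efficiency property: Σ_{i ∈ P} SV_i(v) = v(P). -/
open Finset

/-- The Shapley value of player `i` in the cooperative game with finite player set `P`
and characteristic function `v`. -/
noncomputable def shapleyValue {α : Type*} [DecidableEq α] (P : Finset α)
    (v : Finset α → ℝ) (i : α) : ℝ :=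
  ∑ S ∈ (P \ {i}).powerset,
    ((S.card.factorial * (P.card - S.card - 1).factorial : ℕ) : ℝ)
      / (P.card.factorial : ℕ) * (v (insert i S) - v S)

/-- Summing over the coalitions enlarged by a new member `i` is summing over the coalitions
containing `i`. -/
theorem sum_powerset_sdiff_insert {α M : Type*} [DecidableEq α] [AddCommMonoid M]
    {P : Finset α} {i : α} (hi : i ∈ P) (f : Finset α → M) :
    ∑ S ∈ (P \ {i}).powerset, f (insert i S) = ∑ T ∈ P.powerset with i ∈ T, f T := by
  refine sum_nbij' (insert i) (fun T => T.erase i) ?_ ?_ ?_ ?_ (fun _ _ => rfl)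
  · intro S hS
    simp only [mem_powerset, mem_filter] at *
    grind
  · intro T hT
    simp only [mem_powerset, mem_filter] at *
    grind
  · intro S hS
    simp only [mem_powerset] at hS
    grind
  · intro T hT
    simp only [mem_filter] at hT
    exact insert_erase hT.2

/-- Double counting of the marginal contributions, weighted by coalition size: coalition `T` is
joined last by each of its members, and is joined by each player outside it. -/
theorem sum_sum_marginal {α R : Type*} [DecidableEq α] [CommRing R] (P : Finset α)
    (w : ℕ → R) (v : Finset α → R) :
    ∑ i ∈ P, ∑ S ∈ (P \ {i}).powerset, w #S * (v (insert i S) - v S) =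
      ∑ T ∈ P.powerset, (#T * w (#T - 1) - #(P \ T) * w #T) * v T := by
  have gain : ∑ i ∈ P, ∑ S ∈ (P \ {i}).powerset, w #S * v (insert i S) =
      ∑ T ∈ P.powerset, ∑ _i ∈ T, w (#T - 1) * v T := by
    rw [← sum_comm' (s := P) (t := fun i => P.powerset.filter (i ∈ ·))
      (by simp only [mem_powerset, mem_filter]; grind)]
    refine sum_congr rfl fun i hi => ?_
    rw [← sum_powerset_sdiff_insert hi]
    refine sum_congr rfl fun S hS => ?_
    have hiS : i ∉ S := by
      simp only [mem_powerset] at hS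
      grind
    rw [card_insert_of_notMem hiS, Nat.add_sub_cancel]
  have loss : ∑ i ∈ P, ∑ S ∈ (P \ {i}).powerset, w #S * v S =
      ∑ T ∈ P.powerset, ∑ _i ∈ P \ T, w #T * v T :=
    sum_comm' (by simp only [mem_powerset, mem_sdiff]; grind)
  simp only [mul_sub, sum_sub_distrib, gain, loss, sum_const, nsmul_eq_mul, sub_mul, mul_assoc]

/-- Efficiency axiom: the Shapley values sum to the value of the grand coalition. -/
theorem shapley_efficiency {α : Type*} [DecidableEq α] (P : Finset α)
    (v : Finset α → ℝ) (hv : v ∅ = 0) :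
    ∑ i ∈ P, shapleyValue P v i = v P := by
  have double_count := sum_sum_marginal P
    (fun k => ((k.factorial * (#P - k - 1).factorial : ℕ) : ℝ) / (P.card.factorial : ℕ)) v
  simp only [shapleyValue]
  rw [double_count, sum_eq_single_of_mem P (mem_powerset_self P)]
  · rcases P.eq_empty_or_nonempty with rfl | hP
    · simp [hv]
    · obtain ⟨n, hn⟩ := Nat.exists_eq_succ_of_ne_zero hP.card_ne_zero
      have : (n.factorial : ℝ) ≠ 0 := by positivity
      simp only [hn, Nat.succ_eq_add_one, Nat.factorial_succ, sdiff_self]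
      simp
      field_simp
  · intro T hT hTP
    rcases T.eq_empty_or_nonempty with rfl | hne
    · simp [hv]
    · have hTsub := mem_powerset.mp hT
      have hlt : #T < #P := card_lt_card (hTsub.ssubset_of_ne hTP)
      obtain ⟨k, hk⟩ := Nat.exists_eq_succ_of_ne_zero hne.card_ne_zero
      obtain ⟨m, hm⟩ := Nat.exists_eq_add_of_lt hlt
      rw [card_sdiff_of_subset hTsub, hm, hk]
      have h₁ : k.succ + m + 1 - (k.succ - 1) - 1 = m + 1 := by omega
      have h₂ : k.succ + m + 1 - k.succ - 1 = m := by omega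
      have h₃ : k.succ + m + 1 - k.succ = m + 1 := by omega
      rw [h₁, h₂, h₃]
      simp only [Nat.succ_eq_add_one, Nat.add_sub_cancel, Nat.factorial_succ k,
        Nat.factorial_succ m]
      push_cast
      ring
end

section
/- For a finite set P of N players and a characteristic function v : Finset P → ℝ with v(∅) = 0, the Shapley value of player i given by the coefficient formula SV_i(v) = Σ_{S ⊆ P \ {i}} (|S|! · (N − |S| − 1)! / N!) · (v(S ∪ {i}) − v(S)) equals the average marginal contribution of i over all orderings of players: SV_i(v) = (1/N!) · Σ_{σ a permutation of P} (v(Pred_σ(i) ∪ {i}) − v(Pred_σ(i))), where Pred_σ(i) is the set of players preceding i in the ordering σ. -/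
open Finset

/-- The set of players that arrive strictly before `i` under the ordering
`σ : Fin N ≃ ι` (σ sends arrival positions to players). -/
def predecessors {ι : Type*} [Fintype ι] [DecidableEq ι]
    (σ : Fin (Fintype.card ι) ≃ ι) (i : ι) : Finset ι :=
  Finset.univ.filter fun j => σ.symm j < σ.symm i

section Orderings

variable {ι : Type*} [Fintype ι] [DecidableEq ι]

lemma mem_predecessors {σ : Fin (Fintype.card ι) ≃ ι} {i j : ι} :
    j ∈ predecessors σ i ↔ σ.symm j < σ.symm i := by
  simp [predecessors]

lemma card_predecessors (σ : Fin (Fintype.card ι) ≃ ι) (i : ι) :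
    #(predecessors σ i) = σ.symm i := by
  rw [← Fin.card_Iio (σ.symm i)]
  exact card_equiv σ.symm fun j => by simp [mem_predecessors]

lemma predecessors_trans (σ : Fin (Fintype.card ι) ≃ ι) (π : Equiv.Perm ι) (i : ι) :
    predecessors (σ.trans π) (π i) = (predecessors σ i).map π.toEmbedding := by
  ext j
  simp [mem_predecessors]

/-- A coalition `S` is the set of predecessors of `i` iff it occupies the first positions and
`i` comes right after it. -/
lemma predecessors_eq_iff {σ : Fin (Fintype.card ι) ≃ ι} {i : ι} {S : Finset ι} :
    predecessors σ i = S ↔ Numbering.IsPrefix σ.symm S ∧ (σ.symm i : ℕ) = #S := by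
  constructor
  · rintro rfl
    refine ⟨fun j => ?_, (card_predecessors σ i).symm⟩
    rw [mem_predecessors, card_predecessors, Fin.lt_def]
  · rintro ⟨hS, hi⟩
    ext j
    rw [mem_predecessors, hS j, Fin.lt_def, hi]

lemma card_predecessors_eq_congr {S : Finset ι} {i k : ι} (hi : i ∉ S) (hk : k ∉ S) :
    #{σ : Fin (Fintype.card ι) ≃ ι | predecessors σ k = S} =
      #{σ : Fin (Fintype.card ι) ≃ ι | predecessors σ i = S} := by
  have hS : S.map (Equiv.swap k i).toEmbedding = S := by
    refine eq_of_subset_of_card_le (fun j hj => ?_) (card_map _).ge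
    obtain ⟨l, hl, rfl⟩ := mem_map.1 hj
    rwa [Equiv.coe_toEmbedding, Equiv.swap_apply_of_ne_of_ne] <;> rintro rfl <;> contradiction
  refine card_equiv ((Equiv.refl _).equivCongr (Equiv.swap k i)) fun σ => ?_
  have h := predecessors_trans σ (Equiv.swap k i) k
  rw [Equiv.swap_apply_left] at h
  have h' : (Equiv.refl _).equivCongr (Equiv.swap k i) σ = σ.trans (Equiv.swap k i) := by
    ext; simp
  rw [mem_filter_univ, mem_filter_univ, h', h, ← (map_injective _).eq_iff, hS]

/-- The number of orderings in which the players before `i` are exactly those of `S`. -/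
lemma card_predecessors_eq {S : Finset ι} {i : ι} (hi : i ∉ S) :
    #{σ : Fin (Fintype.card ι) ≃ ι | predecessors σ i = S} =
      (#S).factorial * (Fintype.card ι - #S - 1).factorial := by
  have hlt : #S < Fintype.card ι := card_lt_univ_of_notMem hi
  have hprefix : #{σ : Fin (Fintype.card ι) ≃ ι | Numbering.IsPrefix σ.symm S} =
      (#S).factorial * (Fintype.card ι - #S).factorial := by
    rw [← Numbering.card_prefixed]
    exact card_equiv (Equiv.symmEquiv _ _) fun σ => by simp [Equiv.symmEquiv]
  have hsum : #{σ : Fin (Fintype.card ι) ≃ ι | Numbering.IsPrefix σ.symm S} =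
      ∑ k ∈ Sᶜ, #{σ : Fin (Fintype.card ι) ≃ ι | predecessors σ k = S} := by
    rw [card_eq_sum_card_fiberwise (f := fun σ => σ ⟨#S, hlt⟩) (t := Sᶜ)]
    · refine sum_congr rfl fun k _ => congrArg card ?_
      ext σ
      rw [mem_filter, mem_filter_univ, mem_filter_univ, predecessors_eq_iff,
        ← Equiv.eq_symm_apply, Fin.ext_iff, eq_comm (a := #S)]
    · intro σ hσ
      have hσ : Numbering.IsPrefix σ.symm S := by simpa using hσ
      simp [hσ _]
  rw [sum_congr rfl fun k hk => card_predecessors_eq_congr hi (mem_compl.1 hk), sum_const,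
    card_compl, smul_eq_mul, hprefix,
    ← Nat.mul_factorial_pred (Nat.sub_ne_zero_of_lt hlt), mul_left_comm] at hsum
  exact (Nat.eq_of_mul_eq_mul_left (by lia) hsum).symm

end Orderings

/-- The Shapley value equals the average marginal contribution of player `i`
over all orderings (permutations) of the player set. -/
theorem shapley_eq_average_marginal_contribution {ι : Type*} [Fintype ι] [DecidableEq ι]
    (v : Finset ι → ℝ) (hv : v ∅ = 0) (i : ι) :
    shapleyValue Finset.univ v i =
      (1 / (Fintype.card ι).factorial : ℝ) *
        ∑ σ : Fin (Fintype.card ι) ≃ ι,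
          (v (insert i (predecessors σ i)) - v (predecessors σ i)) := by
  have hmaps : ∀ σ ∈ (univ : Finset (Fin (Fintype.card ι) ≃ ι)),
      predecessors σ i ∈ (univ \ {i}).powerset := fun σ _ => by
    simp [subset_sdiff, mem_predecessors]
  rw [shapleyValue, ← sum_fiberwise_of_maps_to hmaps, mul_sum]
  refine sum_congr rfl fun S hS => ?_
  have hi : i ∉ S := by simpa [subset_sdiff] using hS
  rw [sum_congr rfl (g := fun _ => v (insert i S) - v S) fun σ hσ => by
      rw [(mem_filter.1 hσ).2],
    sum_const, card_predecessors_eq hi, nsmul_eq_mul, card_univ]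
  ring
end

section
/- Uniqueness of the Shapley value: for a finite set P of players, any allocation rule φ assigning to each characteristic function v : Finset P → ℝ with v(∅) = 0 a vector (φ_i(v))_{i ∈ P} of real numbers that satisfies efficiency (Σ_{i ∈ P} φ_i(v) = v(P)), symmetry (if v(S ∪ {i}) = v(S ∪ {j}) for all S ⊆ P \ {i, j} then φ_i(v) = φ_j(v)), linearity (φ_i(a·v + b·w) = a·φ_i(v) + b·φ_i(w) for all scalars a, b and games v, w), and the null player property (if v(S ∪ {i}) = v(S) for all S ⊆ P \ {i} then φ_i(v) = 0), must coincide with the Shapley value: φ_i(v) = Σ_{S ⊆ P \ {i}} (|S|! (N − |S| − 1)! / N!) · (v(S ∪ {i}) − v(S)) for every v and every i ∈ P. -/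
open Finset

/-- The game in which only the coalition `T` has a nonzero worth, namely `1`. -/
def diracGame {α : Type*} [DecidableEq α] (T : Finset α) : Finset α → ℝ :=
  fun S => if S = T then 1 else 0

theorem diracGame_empty {α : Type*} [DecidableEq α] {T : Finset α} (hT : T.Nonempty) :
    diracGame T ∅ = 0 :=
  if_neg hT.ne_empty.symm

section AllocationRule

variable {α : Type*} [DecidableEq α] {P : Finset α} {φ : (Finset α → ℝ) → α → ℝ}

/-- Players on the same side of `T` are paid the same in `diracGame T`. -/
theorem allocation_diracGame_eq_of_mem_iff
    (hsym : ∀ v : Finset α → ℝ, v ∅ = 0 → ∀ i ∈ P, ∀ j ∈ P,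
      (∀ S ⊆ P \ {i, j}, v (insert i S) = v (insert j S)) → φ v i = φ v j)
    {T : Finset α} (hT : T.Nonempty) {i j : α} (hi : i ∈ P) (hj : j ∈ P)
    (hij : i ∈ T ↔ j ∈ T) : φ (diracGame T) i = φ (diracGame T) j := by
  refine hsym _ (diracGame_empty hT) i hi j hj fun S hS => ?_
  rcases eq_or_ne i j with rfl | hne
  · rfl
  have hiS : i ∉ S := fun h => by simpa using hS h
  have hjS : j ∉ S := fun h => by simpa using hS h
  have h₁ : insert i S ≠ T := by
    rintro rfl
    simp_all [eq_comm]
  have h₂ : insert j S ≠ T := by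
    rintro rfl
    simp_all
  simp [diracGame, h₁, h₂]

/-- A player outside `T` is a null player of `diracGame T + diracGame (insert i T)`. -/
theorem allocation_diracGame_of_notMem
    (hlin : ∀ (a b : ℝ) (v w : Finset α → ℝ), v ∅ = 0 → w ∅ = 0 → ∀ i ∈ P,
      φ (fun S => a * v S + b * w S) i = a * φ v i + b * φ w i)
    (hnull : ∀ v : Finset α → ℝ, v ∅ = 0 → ∀ i ∈ P,
      (∀ S ⊆ P \ {i}, v (insert i S) = v S) → φ v i = 0)
    {T : Finset α} (hT : T.Nonempty) {i : α} (hi : i ∈ P) (hiT : i ∉ T) :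
    φ (diracGame T) i = -φ (diracGame (insert i T)) i := by
  have hl := hlin 1 1 _ _ (diracGame_empty hT) (diracGame_empty (insert_nonempty i T)) i hi
  rw [hnull _ (by simp [diracGame_empty, hT]) i hi ?_] at hl
  · linarith
  intro S hS
  have hiS : i ∉ S := fun h => by simpa using hS h
  have h₁ : insert i S ≠ T := by
    rintro rfl
    simp at hiT
  have h₂ : S ≠ insert i T := by
    rintro rfl
    simp at hiS
  have h₃ : insert i S = insert i T ↔ S = T :=
    ⟨fun h => by rw [← erase_insert hiS, h, erase_insert hiT], fun h => by rw [h]⟩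
  simp [diracGame, h₁, h₂, h₃]

theorem allocation_diracGame_of_mem
    (heff : ∀ v : Finset α → ℝ, v ∅ = 0 → ∑ i ∈ P, φ v i = v P)
    (hsym : ∀ v : Finset α → ℝ, v ∅ = 0 → ∀ i ∈ P, ∀ j ∈ P,
      (∀ S ⊆ P \ {i, j}, v (insert i S) = v (insert j S)) → φ v i = φ v j)
    (hlin : ∀ (a b : ℝ) (v w : Finset α → ℝ), v ∅ = 0 → w ∅ = 0 → ∀ i ∈ P,
      φ (fun S => a * v S + b * w S) i = a * φ v i + b * φ w i)
    (hnull : ∀ v : Finset α → ℝ, v ∅ = 0 → ∀ i ∈ P,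
      (∀ S ⊆ P \ {i}, v (insert i S) = v S) → φ v i = 0)
    {T : Finset α} (hTP : T ⊆ P) {i : α} (hi : i ∈ T) :
    φ (diracGame T) i
      = (((#T - 1).factorial * (#P - #T).factorial : ℕ) : ℝ) / (#P).factorial := by
  have hT : T.Nonempty := ⟨i, hi⟩
  have hsplit := heff _ (diracGame_empty hT)
  rw [← sum_sdiff hTP, sum_congr (s₁ := T) rfl fun j hj =>
    allocation_diracGame_eq_of_mem_iff hsym hT (hTP hj) (hTP hi) (by simp [hi, hj]),
    sum_const, nsmul_eq_mul] at hsplit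
  have hfac : (#T : ℝ) * (#T - 1).factorial = (#T).factorial := by
    exact_mod_cast Nat.mul_factorial_pred hT.card_ne_zero
  have hcard : (#T : ℝ) ≠ 0 := by exact_mod_cast hT.card_ne_zero
  have hfacP : ((#P).factorial : ℝ) ≠ 0 := by exact_mod_cast (#P).factorial_ne_zero
  refine mul_left_cancel₀ hcard ?_
  push_cast
  rw [mul_div_assoc', ← mul_assoc, hfac]
  rcases eq_or_ne T P with rfl | hne
  · simp [diracGame] at hsplit
    simp [hsplit, hfacP]
  have hlt : #T < #P := card_lt_card (hTP.ssubset_of_ne hne)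
  have hout : ∀ j ∈ P \ T, φ (diracGame T) j
      = -(((#T).factorial * (#P - #T - 1).factorial : ℕ) / (#P).factorial : ℝ) := by
    intro j hj
    rw [mem_sdiff] at hj
    rw [allocation_diracGame_of_notMem hlin hnull hT hj.1 hj.2,
      allocation_diracGame_of_mem heff hsym hlin hnull (insert_subset hj.1 hTP)
        (mem_insert_self j T), card_insert_of_notMem hj.2, Nat.add_sub_cancel, Nat.sub_sub]
  rw [sum_congr rfl hout, sum_const, nsmul_eq_mul, card_sdiff_of_subset hTP,
    show diracGame T P = 0 from if_neg hne.symm] at hsplit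
  have hfacsub : ((#P - #T : ℕ) : ℝ) * (#P - #T - 1).factorial = (#P - #T).factorial := by
    exact_mod_cast Nat.mul_factorial_pred (by omega)
  rw [← hfacsub]
  push_cast at hsplit ⊢
  linear_combination hsplit
termination_by #P - #T
decreasing_by
  rw [card_insert_of_notMem (mem_sdiff.1 hj).2]
  omega

theorem allocation_sum_diracGame
    (hlin : ∀ (a b : ℝ) (v w : Finset α → ℝ), v ∅ = 0 → w ∅ = 0 → ∀ i ∈ P,
      φ (fun S => a * v S + b * w S) i = a * φ v i + b * φ w i)
    (hnull : ∀ v : Finset α → ℝ, v ∅ = 0 → ∀ i ∈ P,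
      (∀ S ⊆ P \ {i}, v (insert i S) = v S) → φ v i = 0)
    (c : Finset α → ℝ) {i : α} (hi : i ∈ P) (F : Finset (Finset α)) (hF : ∅ ∉ F) :
    φ (fun S => ∑ T ∈ F, c T * diracGame T S) i = ∑ T ∈ F, c T * φ (diracGame T) i := by
  induction F using Finset.induction_on with
  | empty => exact hnull _ (by simp) i hi (by simp)
  | insert T F hTF ih =>
    rw [mem_insert, not_or] at hF
    have hT : T.Nonempty := nonempty_iff_ne_empty.2 (Ne.symm hF.1)
    have hzero : ∑ U ∈ F, c U * diracGame U ∅ = 0 :=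
      sum_eq_zero fun U hU => by
        rw [diracGame_empty (nonempty_iff_ne_empty.2 (ne_of_mem_of_not_mem hU hF.2)), mul_zero]
    have hl := hlin (c T) 1 _ (fun S => ∑ U ∈ F, c U * diracGame U S) (diracGame_empty hT)
      hzero i hi
    simp only [one_mul, ih hF.2] at hl
    simpa only [sum_insert hTF] using hl

/-- The payoffs of the players in `P` depend only on the worths of subcoalitions of `P`. -/
theorem allocation_congr
    (hlin : ∀ (a b : ℝ) (v w : Finset α → ℝ), v ∅ = 0 → w ∅ = 0 → ∀ i ∈ P,
      φ (fun S => a * v S + b * w S) i = a * φ v i + b * φ w i)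
    (hnull : ∀ v : Finset α → ℝ, v ∅ = 0 → ∀ i ∈ P,
      (∀ S ⊆ P \ {i}, v (insert i S) = v S) → φ v i = 0)
    {v w : Finset α → ℝ} (hv : v ∅ = 0) (hvw : ∀ S ⊆ P, v S = w S) {i : α} (hi : i ∈ P) :
    φ v i = φ w i := by
  have hw : w ∅ = 0 := (hvw ∅ (empty_subset P)).symm.trans hv
  have hl := hlin 1 (-1) v w hv hw i hi
  rw [hnull _ (by simp [hv, hw]) i hi ?_] at hl
  · linarith
  intro S hS
  have hSP : S ⊆ P := hS.trans sdiff_subset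
  simp [hvw S hSP, hvw _ (insert_subset hi hSP)]

/-- An allocation rule satisfying linearity and the null player property is determined by
its values on the games `diracGame T`. -/
theorem allocation_eq_sum_powerset
    (hlin : ∀ (a b : ℝ) (v w : Finset α → ℝ), v ∅ = 0 → w ∅ = 0 → ∀ i ∈ P,
      φ (fun S => a * v S + b * w S) i = a * φ v i + b * φ w i)
    (hnull : ∀ v : Finset α → ℝ, v ∅ = 0 → ∀ i ∈ P,
      (∀ S ⊆ P \ {i}, v (insert i S) = v S) → φ v i = 0)
    {v : Finset α → ℝ} (hv : v ∅ = 0) {i : α} (hi : i ∈ P) :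
    φ v i = ∑ T ∈ P.powerset, v T * φ (diracGame T) i := by
  rw [← sum_erase (a := ∅) P.powerset (by rw [hv, zero_mul]),
    ← allocation_sum_diracGame hlin hnull v hi _ (notMem_erase _ _)]
  refine allocation_congr hlin hnull hv (fun S hS => ?_) hi
  rw [sum_erase _ (by rw [hv, zero_mul])]
  simp [diracGame, hS]

end AllocationRule

/-- Uniqueness of the Shapley value: any allocation rule `φ` on cooperative games
over the finite player set `P` (games being characteristic functions `v` with
`v ∅ = 0`) satisfying efficiency, symmetry, linearity, and the null player
property coincides with the Shapley value. -/
theorem shapley_uniqueness {α : Type*} [DecidableEq α] (P : Finset α)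
    (φ : (Finset α → ℝ) → α → ℝ)
    (heff : ∀ v : Finset α → ℝ, v ∅ = 0 → ∑ i ∈ P, φ v i = v P)
    (hsym : ∀ v : Finset α → ℝ, v ∅ = 0 → ∀ i ∈ P, ∀ j ∈ P,
      (∀ S ⊆ P \ {i, j}, v (insert i S) = v (insert j S)) → φ v i = φ v j)
    (hlin : ∀ (a b : ℝ) (v w : Finset α → ℝ), v ∅ = 0 → w ∅ = 0 → ∀ i ∈ P,
      φ (fun S => a * v S + b * w S) i = a * φ v i + b * φ w i)
    (hnull : ∀ v : Finset α → ℝ, v ∅ = 0 → ∀ i ∈ P,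
      (∀ S ⊆ P \ {i}, v (insert i S) = v S) → φ v i = 0) :
    ∀ v : Finset α → ℝ, v ∅ = 0 → ∀ i ∈ P, φ v i = shapleyValue P v i := by
  intro v hv i hi
  have hiP : i ∉ P \ {i} := by simp
  have hP : insert i (P \ {i}) = P := by
    rw [sdiff_singleton_eq_erase, insert_erase hi]
  rw [allocation_eq_sum_powerset hlin hnull hv hi, shapleyValue]
  conv_lhs => rw [← hP]
  rw [sum_powerset_insert hiP, ← sum_add_distrib]
  refine sum_congr rfl fun S hS => ?_
  rw [mem_powerset] at hS
  have hiS : i ∉ S := fun h => hiP (hS h)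
  have hin := allocation_diracGame_of_mem heff hsym hlin hnull
    (insert_subset hi (hS.trans sdiff_subset)) (mem_insert_self i S)
  rw [card_insert_of_notMem hiS, Nat.add_sub_cancel, ← Nat.sub_sub] at hin
  rw [← hin]
  rcases S.eq_empty_or_nonempty with rfl | hne
  · rw [hv]
    ring
  · rw [allocation_diracGame_of_notMem hlin hnull hne hi hiS]
    ring
end
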